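/- Lemma 3.3. Suppose b₁,b₂>0 and conditions (V), (F_0), (F_1), (F_2), (F_3), (F_5) hold. Then every Cerami sequence {(u_n,v_n)}⊂E for Φ has a subsequence converging in the norm of E to some (u,v)∈E. -/

import Mathlib

open Filter Topology

/-- A connected, locally finite weighted graph `G = (V, E)` with symmetric positive edge
weights `w` (vanishing off edges) and a vertex measure `mu` with positive lower bound
`mumin`. -/
structure WeightedGraph (V : Type*) where
  G : SimpleGraph V
  connected : G.Connected
  locallyFinite : ∀ x : V, (G.neighborSet x).Finite
  w : V → V → ℝ
  w_symm : ∀ x y, w x y = w y x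
  w_pos : ∀ x y, G.Adj x y → 0 < w x y
  w_eq_zero : ∀ x y, ¬ G.Adj x y → w x y = 0
  mu : V → ℝ
  mumin : ℝ
  mumin_pos : 0 < mumin
  mu_ge : ∀ x, mumin ≤ mu x

namespace WeightedGraph

variable {V : Type*} (S : WeightedGraph V)

/-- `∫_V φ dμ = Σ_{x ∈ V} φ(x) μ(x)`. -/
noncomputable def integral (φ : V → ℝ) : ℝ := ∑' x, φ x * S.mu x

/-- The graph Laplacian `Δu(x) = (1/μ(x)) Σ_{y ∼ x} w_{xy} (u(y) - u(x))`. -/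
noncomputable def lap (u : V → ℝ) (x : V) : ℝ :=
  (1 / S.mu x) * ∑' y, S.w x y * (u y - u x)

/-- `|∇u|²(x) = (1/(2μ(x))) Σ_{y ∼ x} w_{xy} (u(y) - u(x))²`. -/
noncomputable def gradSq (u : V → ℝ) (x : V) : ℝ :=
  (1 / (2 * S.mu x)) * ∑' y, S.w x y * (u y - u x) ^ 2

/-- `∇u·∇v(x) = (1/(2μ(x))) Σ_{y ∼ x} w_{xy} (u(y) - u(x))(v(y) - v(x))`. -/
noncomputable def gradDot (u v : V → ℝ) (x : V) : ℝ :=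
  (1 / (2 * S.mu x)) * ∑' y, S.w x y * (u y - u x) * (v y - v x)

/-- The `L^r` norm `‖u‖_r = (∫_V |u|^r dμ)^{1/r}` for `1 ≤ r < ∞`. -/
noncomputable def normLr (r : ℝ) (u : V → ℝ) : ℝ :=
  (S.integral fun x => |u x| ^ r) ^ (1 / r)

/-- The density `|Δu|² + a |∇u|² + V(x) u²` defining the norm of the space `E_i`. -/
noncomputable def energyDensity (a : ℝ) (Vp : V → ℝ) (u : V → ℝ) (x : V) : ℝ :=
  (S.lap u x) ^ 2 + a * S.gradSq u x + Vp x * (u x) ^ 2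

/-- Membership in the working space `E_i` (finiteness of the `E_i`-norm). -/
def memE (a : ℝ) (Vp : V → ℝ) (u : V → ℝ) : Prop :=
  Summable fun x => S.energyDensity a Vp u x * S.mu x

/-- The norm `‖u‖_{E_i} = (∫_V (|Δu|² + a_i |∇u|² + V_i(x)u²) dμ)^{1/2}`. -/
noncomputable def normE (a : ℝ) (Vp : V → ℝ) (u : V → ℝ) : ℝ :=
  Real.sqrt (S.integral (S.energyDensity a Vp u))

/-- The inner product `(u,v)_{E_i} = ∫_V (Δu Δv + a_i ∇u·∇v + V_i(x) u v) dμ`. -/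
noncomputable def innerE (a : ℝ) (Vp : V → ℝ) (u v : V → ℝ) : ℝ :=
  S.integral fun x => S.lap u x * S.lap v x + a * S.gradDot u v x + Vp x * u x * v x

/-- The energy functional `Φ` of the biharmonic–Kirchhoff system. -/
noncomputable def Phi (a₁ a₂ b₁ b₂ : ℝ) (V₁ V₂ : V → ℝ) (F : V → ℝ → ℝ → ℝ)
    (u v : V → ℝ) : ℝ :=
  (1/2) * S.integral (S.energyDensity a₁ V₁ u) + (1/2) * S.integral (S.energyDensity a₂ V₂ v)
    + (b₁/4) * (S.integral (S.gradSq u)) ^ 2 + (b₂/4) * (S.integral (S.gradSq v)) ^ 2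
    - S.integral fun x => F x (u x) (v x)

/-- The action `⟨Φ'(u,v), (φ₁,φ₂)⟩` of the derivative of `Φ`. -/
noncomputable def PhiDeriv (a₁ a₂ b₁ b₂ : ℝ) (V₁ V₂ : V → ℝ) (Fs Ft : V → ℝ → ℝ → ℝ)
    (u v φ₁ φ₂ : V → ℝ) : ℝ :=
  S.innerE a₁ V₁ u φ₁ + S.innerE a₂ V₂ v φ₂
    + b₁ * S.integral (S.gradSq u) * S.integral (S.gradDot u φ₁)
    + b₂ * S.integral (S.gradSq v) * S.integral (S.gradDot v φ₂)
    - S.integral (fun x => Fs x (u x) (v x) * φ₁ x)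
    - S.integral (fun x => Ft x (u x) (v x) * φ₂ x)

/-- `(u,v)` solves the biharmonic–Kirchhoff system (pointwise on `V`). -/
def IsSolution (a₁ a₂ b₁ b₂ : ℝ) (V₁ V₂ : V → ℝ) (Fs Ft : V → ℝ → ℝ → ℝ)
    (u v : V → ℝ) : Prop :=
  (∀ x, S.lap (S.lap u) x - (a₁ + b₁ * S.integral (S.gradSq u)) * S.lap u x + V₁ x * u x
      = Fs x (u x) (v x)) ∧
  (∀ x, S.lap (S.lap v) x - (a₂ + b₂ * S.integral (S.gradSq v)) * S.lap v x + V₂ x * v x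
      = Ft x (u x) (v x))

/-- Condition (V): `θᵢ = inf_V Vᵢ > 0` and `Vᵢ(x) → +∞` as `d(x,x₀) → ∞`. -/
def CondV (V₁ V₂ : V → ℝ) (θ₁ θ₂ : ℝ) : Prop :=
  IsGLB (Set.range V₁) θ₁ ∧ IsGLB (Set.range V₂) θ₂ ∧ 0 < θ₁ ∧ 0 < θ₂ ∧
    ∃ x₀ : V, ∀ M : ℝ, ∃ N : ℕ, ∀ x : V, N ≤ S.G.dist x₀ x → M ≤ V₁ x ∧ M ≤ V₂ x

/-- Condition (F₀). -/
def CondF0 (F : V → ℝ → ℝ → ℝ) : Prop :=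
  (∀ x, F x 0 0 = 0) ∧ ∀ x, ContDiff ℝ 1 (fun p : ℝ × ℝ => F x p.1 p.2)

/-- `Fs` and `Ft` are the partial derivatives of `F` in its last two arguments. -/
def IsPartialDerivs (F Fs Ft : V → ℝ → ℝ → ℝ) : Prop :=
  ∀ x s t, HasDerivAt (fun s' => F x s' t) (Fs x s t) s ∧
           HasDerivAt (fun t' => F x s t') (Ft x s t) t

/-- Condition (F₁). -/
def CondF1 (F Fs Ft : V → ℝ → ℝ → ℝ) (a : ℝ → ℝ) (b : V → ℝ) : Prop :=
  ContinuousOn a (Set.Ici 0) ∧ (∀ r : ℝ, 0 ≤ r → 0 ≤ a r) ∧ (∀ x, 0 < b x) ∧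
    Summable (fun x => b x * S.mu x) ∧
    ∀ x s t, |Fs x s t| ≤ a (Real.sqrt (s ^ 2 + t ^ 2)) * b x ∧
             |Ft x s t| ≤ a (Real.sqrt (s ^ 2 + t ^ 2)) * b x ∧
             |F x s t| ≤ a (Real.sqrt (s ^ 2 + t ^ 2)) * b x

/-- Condition (C₁): `lim_{r → 0⁺} a(r)/r² = h < ∞`. -/
def CondC1 (a : ℝ → ℝ) : Prop :=
  ∃ h : ℝ, Tendsto (fun r => a r / r ^ 2) (nhdsWithin 0 (Set.Ioi 0)) (nhds h)

/-- `γ_{∞,i} = (μ_min · inf_V V_i)^{-1/2}`. -/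
noncomputable def gammaInf (θ : ℝ) : ℝ := 1 / Real.sqrt (S.mumin * θ)

/-- Condition (C₂). -/
def CondC2 (a : ℝ → ℝ) (b : V → ℝ) (θ₁ θ₂ : ℝ) : Prop :=
  ∃ ρ : ℝ, 0 < ρ ∧
    0 < ρ ^ 2 / 4 - sSup (a '' Set.Icc 0 ((S.gammaInf θ₁ + S.gammaInf θ₂) * ρ)) * S.integral b

/-- Condition (F₂): `F(x,s,t)/|(s,t)|⁴ → +∞` as `|(s,t)| → ∞`, uniformly in `x`. -/
def CondF2 (F : V → ℝ → ℝ → ℝ) : Prop :=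
  ∀ M : ℝ, ∃ R : ℝ, ∀ x s t, R ≤ Real.sqrt (s ^ 2 + t ^ 2) → M * (s ^ 2 + t ^ 2) ^ 2 ≤ F x s t

/-- Condition (F₂)': `F(x,s,t)/|(s,t)|² → +∞` as `|(s,t)| → ∞`, uniformly in `x`. -/
def CondF2' (F : V → ℝ → ℝ → ℝ) : Prop :=
  ∀ M : ℝ, ∃ R : ℝ, ∀ x s t, R ≤ Real.sqrt (s ^ 2 + t ^ 2) → M * (s ^ 2 + t ^ 2) ≤ F x s t

/-- Condition (F₃): `F ≥ 0` outside the ball of radius `r₀`. -/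
def CondF3 (F : V → ℝ → ℝ → ℝ) (r₀ : ℝ) : Prop :=
  ∀ x s t, r₀ ≤ Real.sqrt (s ^ 2 + t ^ 2) → 0 ≤ F x s t

/-- `𝓕(x,s,t) = λ (s F_s + t F_t) - F` (with `λ = 1/4` resp. `1/2`). -/
noncomputable def curlyF (lam : ℝ) (F Fs Ft : V → ℝ → ℝ → ℝ) (x : V) (s t : ℝ) : ℝ :=
  lam * (s * Fs x s t + t * Ft x s t) - F x s t

/-- Condition (F₄) (with `λ = 1/4`); `k` is a real exponent and `^` is `Real.rpow`. -/
def CondF4 (F Fs Ft : V → ℝ → ℝ → ℝ) (r₀ : ℝ) : Prop :=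
  (∀ (x : V) (s t : ℝ), 0 ≤ curlyF (1/4) F Fs Ft x s t) ∧
  ∃ c : ℝ, 0 < c ∧ ∃ k : ℝ, 1 < k ∧ ∀ (x : V) (s t : ℝ), r₀ ≤ Real.sqrt (s ^ 2 + t ^ 2) →
    |F x s t| ^ k ≤ c * (s ^ 2 + t ^ 2) ^ k * curlyF (1/4) F Fs Ft x s t

/-- Condition (F₄)' (with `λ = 1/2`). -/
def CondF4' (F Fs Ft : V → ℝ → ℝ → ℝ) (r₀ : ℝ) : Prop :=
  (∀ (x : V) (s t : ℝ), 0 ≤ curlyF (1/2) F Fs Ft x s t) ∧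
  ∃ c : ℝ, 0 < c ∧ ∃ k : ℝ, 1 < k ∧ ∀ (x : V) (s t : ℝ), r₀ ≤ Real.sqrt (s ^ 2 + t ^ 2) →
    |F x s t| ^ k ≤ c * (s ^ 2 + t ^ 2) ^ k * curlyF (1/2) F Fs Ft x s t

/-- `γ_{2,i} = (inf_V V_i)^{-1/2}`. -/
noncomputable def gamma2 (θ : ℝ) : ℝ := 1 / Real.sqrt θ

/-- Condition (F₅) (`lb = 4`), resp. (F₅)' (`lb = 2`): there are `μ̄ > lb` and an admissible
`σ` with `μ̄ F ≤ s F_s + t F_t + σ (s² + t²)`. -/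
def CondF5 (lb : ℝ) (F Fs Ft : V → ℝ → ℝ → ℝ) (θ₁ θ₂ : ℝ) : Prop :=
  ∃ μb : ℝ, lb < μb ∧ ∃ σ : ℝ, 0 < σ ∧
    σ < (μb - 2) / (2 * max (gamma2 θ₁ ^ 2) (gamma2 θ₂ ^ 2)) ∧
    ∀ (x : V) (s t : ℝ), μb * F x s t ≤ s * Fs x s t + t * Ft x s t + σ * (s ^ 2 + t ^ 2)

/-- Condition (F₆): `F` is even in `(s,t)`. -/
def CondF6 (F : V → ℝ → ℝ → ℝ) : Prop :=
  ∀ (x : V) (s t : ℝ), F x (-s) (-t) = F x s t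

/-- A Cerami sequence for `Φ`: `Φ(uₙ,vₙ)` is bounded and
`(1 + ‖(uₙ,vₙ)‖)‖Φ'(uₙ,vₙ)‖_{E*} → 0`. -/
def CeramiSeq (a₁ a₂ b₁ b₂ : ℝ) (V₁ V₂ : V → ℝ) (F Fs Ft : V → ℝ → ℝ → ℝ)
    (u v : ℕ → V → ℝ) : Prop :=
  (∀ n, S.memE a₁ V₁ (u n) ∧ S.memE a₂ V₂ (v n)) ∧
  (∃ C : ℝ, ∀ n, |S.Phi a₁ a₂ b₁ b₂ V₁ V₂ F (u n) (v n)| ≤ C) ∧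
  ∃ ε : ℕ → ℝ, Tendsto ε atTop (nhds 0) ∧
    ∀ (n : ℕ) (φ₁ φ₂ : V → ℝ), S.memE a₁ V₁ φ₁ → S.memE a₂ V₂ φ₂ →
      S.normE a₁ V₁ φ₁ + S.normE a₂ V₂ φ₂ ≤ 1 →
      (1 + (S.normE a₁ V₁ (u n) + S.normE a₂ V₂ (v n))) *
        |S.PhiDeriv a₁ a₂ b₁ b₂ V₁ V₂ Fs Ft (u n) (v n) φ₁ φ₂| ≤ ε n

end WeightedGraph

open WeightedGraph

section BilinFormFamily

variable {ι E : Type*} [AddCommGroup E] [Module ℝ E] {B : ι → LinearMap.BilinForm ℝ E}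

/-- Young's inequality for a positive semidefinite bilinear form. -/
lemma LinearMap.BilinForm.IsPosSemidef.abs_apply_le {B : LinearMap.BilinForm ℝ E}
    (hB : B.IsPosSemidef) (u v : E) {t : ℝ} (ht : 0 < t) :
    |B u v| ≤ (t * B u u + t⁻¹ * B v v) / 2 := by
  have key : ∀ c : ℝ, 0 ≤ B (t • u + c • v) (t • u + c • v) := fun c => hB.nonneg _
  have hs : B v u = B u v := hB.eq v u
  have h1 := key 1
  have h2 := key (-1)
  simp only [map_add, map_smul, LinearMap.add_apply, LinearMap.smul_apply, smul_eq_mul, hs]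
    at h1 h2
  have ht' : t * t⁻¹ = 1 := mul_inv_cancel₀ ht.ne'
  have e : t * ((t * B u u + t⁻¹ * B v v) / 2) = (t * (t * B u u) + B v v) / 2 := by
    linear_combination (B v v / 2) * ht'
  refine le_of_mul_le_mul_left ?_ ht
  rw [e, ← abs_of_pos ht, ← abs_mul, abs_of_pos ht]
  exact abs_le.2 ⟨by linarith, by linarith⟩

lemma summable_bilin (hB : ∀ i, (B i).IsPosSemidef) {u v : E}
    (hu : Summable fun i => B i u u) (hv : Summable fun i => B i v v) :
    Summable fun i => B i u v := by
  refine Summable.of_norm_bounded ((hu.add hv).div_const 2) fun i => ?_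
  simpa using (hB i).abs_apply_le u v one_pos

lemma bilin_sub_self_le {B : LinearMap.BilinForm ℝ E} (hB : B.IsPosSemidef) (u v : E) :
    B (u - v) (u - v) ≤ 2 * B u u + 2 * B v v := by
  have h := hB.nonneg (u + v)
  simp only [map_add, map_sub, LinearMap.add_apply, LinearMap.sub_apply] at h ⊢
  linarith

lemma summable_bilin_sub (hB : ∀ i, (B i).IsPosSemidef) {u v : E}
    (hu : Summable fun i => B i u u) (hv : Summable fun i => B i v v) :
    Summable fun i => B i (u - v) (u - v) :=
  Summable.of_nonneg_of_le (fun i => (hB i).nonneg _) (fun i => bilin_sub_self_le (hB i) u v)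
    ((hu.mul_left 2).add (hv.mul_left 2))

lemma tsum_bilin_sub_le (hB : ∀ i, (B i).IsPosSemidef) {u v : E}
    (hu : Summable fun i => B i u u) (hv : Summable fun i => B i v v) :
    ∑' i, B i (u - v) (u - v) ≤ 2 * ∑' i, B i u u + 2 * ∑' i, B i v v := by
  rw [← tsum_mul_left, ← tsum_mul_left, ← (hu.mul_left 2).tsum_add (hv.mul_left 2)]
  exact (summable_bilin_sub hB hu hv).tsum_le_tsum (fun i => bilin_sub_self_le (hB i) u v)
    ((hu.mul_left 2).add (hv.mul_left 2))

lemma tsum_bilin_sub_right (hB : ∀ i, (B i).IsPosSemidef) {u v : E}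
    (hu : Summable fun i => B i u u) (hv : Summable fun i => B i v v) :
    ∑' i, B i u (u - v) = ∑' i, B i (u - v) (u - v) + ∑' i, B i v (u - v) := by
  have hs := summable_bilin_sub hB hu hv
  rw [← hs.tsum_add (summable_bilin hB hv hs)]
  refine tsum_congr fun i => ?_
  rw [← LinearMap.add_apply, ← map_add, sub_add_cancel]

/-- Energy-bounded sequences that converge to `0` pointwise converge to `0` weakly. -/
lemma tendsto_tsum_bilin_zero (hB : ∀ i, (B i).IsPosSemidef) {u : E} {w : ℕ → E} {C : ℝ}
    (hu : Summable fun i => B i u u) (hw : ∀ n, Summable fun i => B i (w n) (w n))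
    (hC : ∀ n, ∑' i, B i (w n) (w n) ≤ C)
    (h0 : ∀ i, Tendsto (fun n => B i u (w n)) atTop (𝓝 0)) :
    Tendsto (fun n => ∑' i, B i u (w n)) atTop (𝓝 0) := by
  have hC0 : 0 ≤ C := (tsum_nonneg fun i => (hB i).nonneg _).trans (hC 0)
  rw [Metric.tendsto_atTop]
  intro ε hε
  obtain ⟨t, ht, htC⟩ : ∃ t : ℝ, 0 < t ∧ t⁻¹ / 2 * C < ε / 2 := by
    refine ⟨(C + 1) / ε, by positivity, ?_⟩
    rw [inv_div, div_div, div_mul_eq_mul_div, div_lt_div_iff₀ (by positivity) two_pos]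
    nlinarith
  have hmin : Tendsto (fun n => ∑' i, min |B i u (w n)| (t / 2 * B i u u)) atTop (𝓝 0) := by
    have := tendsto_tsum_of_dominated_convergence
      (f := fun n i => min |B i u (w n)| (t / 2 * B i u u)) (g := fun _ => (0 : ℝ))
      (𝓕 := atTop) (hu.mul_left (t / 2)) ?_ ?_
    · simpa using this
    · intro i
      have h := (h0 i).abs.min (tendsto_const_nhds (x := t / 2 * B i u u))
      have hn : 0 ≤ t / 2 * B i u u := mul_nonneg (by positivity) ((hB i).nonneg u)
      simpa [min_eq_left hn] using h
    · refine Eventually.of_forall fun n i => ?_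
      have hn : 0 ≤ t / 2 * B i u u := mul_nonneg (by positivity) ((hB i).nonneg u)
      rw [Real.norm_of_nonneg (le_min (abs_nonneg _) hn)]
      exact min_le_right _ _
  obtain ⟨N, hN⟩ := Metric.tendsto_atTop.1 hmin (ε / 2) (half_pos hε)
  refine ⟨N, fun n hn => ?_⟩
  have hmins : Summable fun i => min |B i u (w n)| (t / 2 * B i u u) := by
    refine Summable.of_nonneg_of_le (fun i => le_min (abs_nonneg _) ?_)
      (fun i => min_le_right _ _) (hu.mul_left (t / 2))
    exact mul_nonneg (by positivity) ((hB i).nonneg u)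
  have hw' := (hw n).mul_left (t⁻¹ / 2)
  have hle : ∀ i, ‖B i u (w n)‖ ≤
      min |B i u (w n)| (t / 2 * B i u u) + t⁻¹ / 2 * B i (w n) (w n) := fun i => by
    have h1 := (hB i).abs_apply_le u (w n) ht
    have h2 : 0 ≤ t⁻¹ / 2 * B i (w n) (w n) := mul_nonneg (by positivity) ((hB i).nonneg _)
    rw [Real.norm_eq_abs]
    rcases min_cases |B i u (w n)| (t / 2 * B i u u) with h | h <;> linarith
  have hb := tsum_of_norm_bounded (hmins.add hw').hasSum hle
  rw [hmins.tsum_add hw', tsum_mul_left] at hb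
  have h1 := hN n hn
  rw [dist_zero_right] at h1 ⊢
  have h2 := mul_le_mul_of_nonneg_left (hC n) (by positivity : 0 ≤ t⁻¹ / 2)
  linarith [le_abs_self (∑' i, min |B i u (w n)| (t / 2 * B i u u)),
    Real.norm_eq_abs (∑' i, min |B i u (w n)| (t / 2 * B i u u))]

/-- Fatou's lemma for the energy of a pointwise limit. -/
lemma summable_bilin_of_tendsto (hB : ∀ i, (B i).IsPosSemidef) {u : E} {w : ℕ → E} {C : ℝ}
    (hw : ∀ n, Summable fun i => B i (w n) (w n)) (hC : ∀ n, ∑' i, B i (w n) (w n) ≤ C)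
    (h : ∀ i, Tendsto (fun n => B i (w n) (w n)) atTop (𝓝 (B i u u))) :
    Summable fun i => B i u u := by
  refine summable_of_sum_le (c := C) (fun i => (hB i).nonneg u) fun s => ?_
  refine le_of_tendsto' (tendsto_finsetSum s fun i _ => h i) fun n => ?_
  exact ((hw n).sum_le_tsum s fun i _ => (hB i).nonneg _).trans (hC n)

end BilinFormFamily

namespace WeightedGraph

variable {V : Type*} (S : WeightedGraph V)

lemma mu_pos (x : V) : 0 < S.mu x := S.mumin_pos.trans_le (S.mu_ge x)

lemma w_nonneg (x y : V) : 0 ≤ S.w x y := by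
  by_cases h : S.G.Adj x y
  · exact (S.w_pos x y h).le
  · exact (S.w_eq_zero x y h).ge

/-- The finite set of neighbours of `x`. -/
noncomputable def nbrs (x : V) : Finset V := (S.locallyFinite x).toFinset

lemma tsum_w_mul (x : V) (f : V → ℝ) :
    ∑' y, S.w x y * f y = ∑ y ∈ S.nbrs x, S.w x y * f y := by
  refine tsum_eq_sum fun y hy => ?_
  rw [S.w_eq_zero x y (by simpa [nbrs] using hy), zero_mul]

/-- The linear functional `u ↦ u(y) - u(x)`. -/
def diffLin (x y : V) : (V → ℝ) →ₗ[ℝ] ℝ :=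
  (LinearMap.proj y : (V → ℝ) →ₗ[ℝ] ℝ) - LinearMap.proj x

/-- The linear functional `u ↦ Δu(x)`. -/
noncomputable def lapLin (x : V) : (V → ℝ) →ₗ[ℝ] ℝ :=
  (1 / S.mu x) • ∑ y ∈ S.nbrs x, S.w x y • diffLin x y

lemma lapLin_apply (x : V) (u : V → ℝ) : S.lapLin x u = S.lap u x := by
  simp [lapLin, lap, diffLin, S.tsum_w_mul]

/-- The form `(u, v) ↦ (∇u·∇v)(x) μ(x)`. -/
noncomputable def gradForm (x : V) : LinearMap.BilinForm ℝ (V → ℝ) :=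
  ∑ y ∈ S.nbrs x, (S.w x y / 2) •
    LinearMap.BilinForm.linMulLin (diffLin x y) (diffLin x y)

/-- The form `(u, v) ↦ (Δu Δv + a ∇u·∇v + Vp u v)(x) μ(x)`. -/
noncomputable def energyForm (a : ℝ) (Vp : V → ℝ) (x : V) : LinearMap.BilinForm ℝ (V → ℝ) :=
  S.mu x • LinearMap.BilinForm.linMulLin (S.lapLin x) (S.lapLin x) + a • S.gradForm x +
    (Vp x * S.mu x) • LinearMap.BilinForm.linMulLin (LinearMap.proj x) (LinearMap.proj x)

lemma gradForm_apply (x : V) (u v : V → ℝ) : S.gradForm x u v = S.gradDot u v x * S.mu x := by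
  have hm := (S.mu_pos x).ne'
  simp only [gradForm, gradDot, mul_assoc, S.tsum_w_mul, LinearMap.sum_apply,
    LinearMap.smul_apply, LinearMap.BilinForm.linMulLin_apply, diffLin, LinearMap.sub_apply,
    LinearMap.proj_apply, smul_eq_mul, Finset.mul_sum, Finset.sum_mul]
  refine Finset.sum_congr rfl fun y _ => ?_
  field_simp

lemma gradSq_eq_gradDot (u : V → ℝ) : S.gradSq u = S.gradDot u u := by
  funext x
  simp only [gradSq, gradDot, sq, mul_assoc]

lemma energyForm_apply (a : ℝ) (Vp : V → ℝ) (x : V) (u v : V → ℝ) :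
    S.energyForm a Vp x u v =
      (S.lap u x * S.lap v x + a * S.gradDot u v x + Vp x * u x * v x) * S.mu x := by
  simp only [energyForm, LinearMap.add_apply, LinearMap.smul_apply,
    LinearMap.BilinForm.linMulLin_apply, lapLin_apply, gradForm_apply, LinearMap.proj_apply,
    smul_eq_mul]
  ring

lemma energyForm_self (a : ℝ) (Vp : V → ℝ) (x : V) (u : V → ℝ) :
    S.energyForm a Vp x u u = S.energyDensity a Vp u x * S.mu x := by
  rw [energyForm_apply, energyDensity, gradSq_eq_gradDot]
  ring

lemma gradForm_isPosSemidef (x : V) : (S.gradForm x).IsPosSemidef where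
  eq u v := by
    simp only [gradForm_apply, gradDot]
    congr 2
    exact tsum_congr fun y => by ring
  nonneg u := by
    rw [gradForm_apply, ← gradSq_eq_gradDot, gradSq]
    have := S.mu_pos x
    have : 0 ≤ ∑' y, S.w x y * (u y - u x) ^ 2 :=
      tsum_nonneg fun y => mul_nonneg (S.w_nonneg x y) (sq_nonneg _)
    positivity

lemma energyForm_isPosSemidef {a : ℝ} {Vp : V → ℝ} (ha : 0 ≤ a) (hVp : ∀ x, 0 ≤ Vp x) (x : V) :
    (S.energyForm a Vp x).IsPosSemidef where
  eq u v := by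
    have h := (S.gradForm_isPosSemidef x).eq u v
    simp only [gradForm_apply, energyForm_apply] at h ⊢
    linear_combination a * h
  nonneg u := by
    have h := (S.gradForm_isPosSemidef x).nonneg u
    rw [gradForm_apply] at h
    rw [energyForm_apply]
    have h1 := mul_nonneg (mul_nonneg (hVp x) (mul_self_nonneg (u x))) (S.mu_pos x).le
    have h2 := mul_nonneg (mul_self_nonneg (S.lap u x)) (S.mu_pos x).le
    have h3 := mul_nonneg ha h
    linarith

/-- A bilinear form given by finitely many evaluations is continuous for pointwise convergence. -/
lemma tendsto_gradForm {x : V} {u w : ℕ → V → ℝ} {u₀ w₀ : V → ℝ}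
    (hu : Tendsto u atTop (𝓝 u₀)) (hw : Tendsto w atTop (𝓝 w₀)) :
    Tendsto (fun n => S.gradForm x (u n) (w n)) atTop (𝓝 (S.gradForm x u₀ w₀)) := by
  rw [tendsto_pi_nhds] at hu hw
  simp only [gradForm, LinearMap.sum_apply, LinearMap.smul_apply,
    LinearMap.BilinForm.linMulLin_apply, diffLin, LinearMap.sub_apply, LinearMap.proj_apply]
  exact tendsto_finsetSum _ fun y _ =>
    (((hu y).sub (hu x)).mul ((hw y).sub (hw x))).const_smul _

lemma tendsto_lap {x : V} {u : ℕ → V → ℝ} {u₀ : V → ℝ} (hu : Tendsto u atTop (𝓝 u₀)) :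
    Tendsto (fun n => S.lap (u n) x) atTop (𝓝 (S.lap u₀ x)) := by
  rw [tendsto_pi_nhds] at hu
  simp only [lap, S.tsum_w_mul]
  exact (tendsto_finsetSum _ fun y _ => ((hu y).sub (hu x)).const_mul _).const_mul _

lemma tendsto_energyForm {a : ℝ} {Vp : V → ℝ} {x : V} {u w : ℕ → V → ℝ} {u₀ w₀ : V → ℝ}
    (hu : Tendsto u atTop (𝓝 u₀)) (hw : Tendsto w atTop (𝓝 w₀)) :
    Tendsto (fun n => S.energyForm a Vp x (u n) (w n)) atTop
      (𝓝 (S.energyForm a Vp x u₀ w₀)) := by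
  have hg := S.tendsto_gradForm (x := x) hu hw
  have hux := tendsto_pi_nhds.1 hu x
  have hwx := tendsto_pi_nhds.1 hw x
  simp only [energyForm, LinearMap.add_apply, LinearMap.smul_apply,
    LinearMap.BilinForm.linMulLin_apply, lapLin_apply, LinearMap.proj_apply]
  exact ((((S.tendsto_lap hu).mul (S.tendsto_lap hw)).const_smul _).add (hg.const_smul _)).add
    ((hux.mul hwx).const_smul _)

lemma integral_energyDensity (a : ℝ) (Vp u : V → ℝ) :
    S.integral (S.energyDensity a Vp u) = ∑' x, S.energyForm a Vp x u u :=
  tsum_congr fun x => (S.energyForm_self a Vp x u).symm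

lemma memE_iff {a : ℝ} {Vp u : V → ℝ} :
    S.memE a Vp u ↔ Summable fun x => S.energyForm a Vp x u u := by
  simp only [memE, energyForm_self]

lemma innerE_eq (a : ℝ) (Vp u v : V → ℝ) :
    S.innerE a Vp u v = ∑' x, S.energyForm a Vp x u v :=
  tsum_congr fun x => (S.energyForm_apply a Vp x u v).symm

lemma integral_gradDot (u v : V → ℝ) : S.integral (S.gradDot u v) = ∑' x, S.gradForm x u v :=
  tsum_congr fun x => (S.gradForm_apply x u v).symm

lemma innerE_smul_right (a c : ℝ) (Vp u v : V → ℝ) :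
    S.innerE a Vp u (c • v) = c * S.innerE a Vp u v := by
  simp only [innerE_eq, map_smul, smul_eq_mul, tsum_mul_left]

lemma integral_gradDot_smul_right (c : ℝ) (u v : V → ℝ) :
    S.integral (S.gradDot u (c • v)) = c * S.integral (S.gradDot u v) := by
  simp only [integral_gradDot, map_smul, smul_eq_mul, tsum_mul_left]

lemma integral_mul_smul_right (c : ℝ) (f v : V → ℝ) :
    S.integral (fun x => f x * (c • v) x) = c * S.integral fun x => f x * v x := by
  rw [integral, integral, ← tsum_mul_left]
  exact tsum_congr fun x => by simp only [Pi.smul_apply, smul_eq_mul]; ring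

lemma PhiDeriv_smul (a₁ a₂ b₁ b₂ c : ℝ) (V₁ V₂ : V → ℝ) (Fs Ft : V → ℝ → ℝ → ℝ)
    (u v φ₁ φ₂ : V → ℝ) :
    S.PhiDeriv a₁ a₂ b₁ b₂ V₁ V₂ Fs Ft u v (c • φ₁) (c • φ₂) =
      c * S.PhiDeriv a₁ a₂ b₁ b₂ V₁ V₂ Fs Ft u v φ₁ φ₂ := by
  simp only [PhiDeriv, innerE_smul_right, integral_gradDot_smul_right, integral_mul_smul_right]
  ring

lemma memE_smul {a : ℝ} {Vp u : V → ℝ} (c : ℝ) (hu : S.memE a Vp u) : S.memE a Vp (c • u) := by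
  rw [memE_iff] at hu ⊢
  simpa only [map_smul, LinearMap.smul_apply, smul_eq_mul] using (hu.mul_left c).mul_left c

lemma normE_smul (a : ℝ) (Vp u : V → ℝ) {c : ℝ} (hc : 0 ≤ c) :
    S.normE a Vp (c • u) = c * S.normE a Vp u := by
  simp only [normE, integral_energyDensity, map_smul, LinearMap.smul_apply, smul_eq_mul,
    tsum_mul_left]
  rw [← mul_assoc, Real.sqrt_mul (mul_nonneg hc hc), Real.sqrt_mul_self hc]

lemma normE_nonneg (a : ℝ) (Vp u : V → ℝ) : 0 ≤ S.normE a Vp u := Real.sqrt_nonneg _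

/-- A bound for `Φ'` on the unit ball of `E` extends to all of `E`. -/
lemma abs_PhiDeriv_le {a₁ a₂ b₁ b₂ N ε : ℝ} {V₁ V₂ : V → ℝ} {Fs Ft : V → ℝ → ℝ → ℝ}
    {u v : V → ℝ}
    (h : ∀ φ₁ φ₂ : V → ℝ, S.memE a₁ V₁ φ₁ → S.memE a₂ V₂ φ₂ →
      S.normE a₁ V₁ φ₁ + S.normE a₂ V₂ φ₂ ≤ 1 →
      N * |S.PhiDeriv a₁ a₂ b₁ b₂ V₁ V₂ Fs Ft u v φ₁ φ₂| ≤ ε)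
    {φ₁ φ₂ : V → ℝ} (h₁ : S.memE a₁ V₁ φ₁) (h₂ : S.memE a₂ V₂ φ₂) :
    N * |S.PhiDeriv a₁ a₂ b₁ b₂ V₁ V₂ Fs Ft u v φ₁ φ₂| ≤
      ε * (1 + (S.normE a₁ V₁ φ₁ + S.normE a₂ V₂ φ₂)) := by
  have n1 := S.normE_nonneg a₁ V₁ φ₁
  have n2 := S.normE_nonneg a₂ V₂ φ₂
  set M := 1 + (S.normE a₁ V₁ φ₁ + S.normE a₂ V₂ φ₂) with hM
  have hM0 : 0 < M := by positivity
  have hM1 : 0 ≤ M⁻¹ := by positivity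
  have := h (M⁻¹ • φ₁) (M⁻¹ • φ₂) (S.memE_smul _ h₁) (S.memE_smul _ h₂) (by
    rw [normE_smul _ _ _ _ hM1, normE_smul _ _ _ _ hM1, ← mul_add, inv_mul_le_iff₀ hM0]
    linarith)
  rw [PhiDeriv_smul, abs_mul, abs_of_nonneg hM1, mul_left_comm, inv_mul_le_iff₀ hM0] at this
  linarith

section Energy

variable {S}
variable {a θ : ℝ} {Vp : V → ℝ}

lemma energyForm_isPosSemidef_of_le (ha : 0 < a) (hθ : 0 < θ) (hVp : ∀ x, θ ≤ Vp x) (x : V) :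
    (S.energyForm a Vp x).IsPosSemidef :=
  S.energyForm_isPosSemidef ha.le (fun x => hθ.le.trans (hVp x)) x

lemma gradForm_le_energyForm (hθ : 0 < θ) (hVp : ∀ x, θ ≤ Vp x) (x : V) (u : V → ℝ) :
    a * S.gradForm x u u ≤ S.energyForm a Vp x u u := by
  rw [gradForm_apply, energyForm_apply]
  have h1 := mul_nonneg (mul_nonneg (hθ.le.trans (hVp x)) (mul_self_nonneg (u x))) (S.mu_pos x).le
  have h2 := mul_nonneg (mul_self_nonneg (S.lap u x)) (S.mu_pos x).le
  linarith

lemma sq_mul_mu_le_energyForm (ha : 0 < a) (hVp : ∀ x, θ ≤ Vp x) (x : V) (u : V → ℝ) :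
    θ * (u x ^ 2 * S.mu x) ≤ S.energyForm a Vp x u u := by
  have h := (S.gradForm_isPosSemidef x).nonneg u
  rw [gradForm_apply] at h
  rw [energyForm_apply]
  have h1 := mul_le_mul_of_nonneg_right (hVp x)
    (mul_nonneg (sq_nonneg (u x)) (S.mu_pos x).le)
  have h2 := mul_nonneg (mul_self_nonneg (S.lap u x)) (S.mu_pos x).le
  have h3 := mul_nonneg ha.le h
  linarith

lemma summable_gradForm (ha : 0 < a) (hθ : 0 < θ) (hVp : ∀ x, θ ≤ Vp x) {u : V → ℝ}
    (hu : S.memE a Vp u) : Summable fun x => S.gradForm x u u := by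
  refine Summable.of_nonneg_of_le (fun x => (S.gradForm_isPosSemidef x).nonneg u) (fun x => ?_)
    ((S.memE_iff.1 hu).mul_left a⁻¹)
  rw [← div_eq_inv_mul, le_div_iff₀' ha]
  exact gradForm_le_energyForm hθ hVp x u

lemma integral_gradSq_le (ha : 0 < a) (hθ : 0 < θ) (hVp : ∀ x, θ ≤ Vp x) {u : V → ℝ}
    (hu : S.memE a Vp u) :
    a * S.integral (S.gradSq u) ≤ S.integral (S.energyDensity a Vp u) := by
  rw [gradSq_eq_gradDot, integral_gradDot, integral_energyDensity, ← tsum_mul_left]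
  exact ((summable_gradForm ha hθ hVp hu).mul_left a).tsum_le_tsum
    (fun x => gradForm_le_energyForm hθ hVp x u) (S.memE_iff.1 hu)

lemma integral_gradSq_nonneg (u : V → ℝ) : 0 ≤ S.integral (S.gradSq u) := by
  rw [gradSq_eq_gradDot, integral_gradDot]
  exact tsum_nonneg fun x => (S.gradForm_isPosSemidef x).nonneg u

lemma integral_energyDensity_nonneg (ha : 0 < a) (hθ : 0 < θ) (hVp : ∀ x, θ ≤ Vp x)
    (u : V → ℝ) : 0 ≤ S.integral (S.energyDensity a Vp u) := by
  rw [integral_energyDensity]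
  exact tsum_nonneg fun x => (energyForm_isPosSemidef_of_le ha hθ hVp x).nonneg u

lemma summable_sq_mul_mu (ha : 0 < a) (hθ : 0 < θ) (hVp : ∀ x, θ ≤ Vp x) {u : V → ℝ}
    (hu : S.memE a Vp u) : Summable fun x => u x ^ 2 * S.mu x := by
  refine Summable.of_nonneg_of_le (fun x => mul_nonneg (sq_nonneg _) (S.mu_pos x).le)
    (fun x => ?_) ((S.memE_iff.1 hu).mul_left θ⁻¹)
  rw [← div_eq_inv_mul, le_div_iff₀' hθ]
  exact sq_mul_mu_le_energyForm ha hVp x u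

lemma integral_sq_le (ha : 0 < a) (hθ : 0 < θ) (hVp : ∀ x, θ ≤ Vp x) {u : V → ℝ}
    (hu : S.memE a Vp u) :
    θ * ∑' x, u x ^ 2 * S.mu x ≤ S.integral (S.energyDensity a Vp u) := by
  rw [integral_energyDensity, ← tsum_mul_left]
  exact ((summable_sq_mul_mu ha hθ hVp hu).mul_left θ).tsum_le_tsum
    (fun x => sq_mul_mu_le_energyForm ha hVp x u) (S.memE_iff.1 hu)

/-- The embedding of `E_i` into `ℓ^∞`. -/
lemma abs_le_of_integral_energyDensity_le (ha : 0 < a) (hθ : 0 < θ) (hVp : ∀ x, θ ≤ Vp x)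
    {K : ℝ} {u : V → ℝ} (hu : S.memE a Vp u) (hK : S.integral (S.energyDensity a Vp u) ≤ K)
    (x : V) : |u x| ≤ √(K / (θ * S.mumin)) := by
  refine Real.abs_le_sqrt ?_
  rw [le_div_iff₀ (mul_pos hθ S.mumin_pos)]
  have h1 := (S.memE_iff.1 hu).le_tsum x
    fun y _ => (energyForm_isPosSemidef_of_le ha hθ hVp y).nonneg u
  rw [← integral_energyDensity] at h1
  have h2 := sq_mul_mu_le_energyForm (S := S) ha hVp x u
  have h3 := mul_le_mul_of_nonneg_left (S.mu_ge x) (mul_nonneg hθ.le (sq_nonneg (u x)))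
  linarith

/-- The weak limit argument for one component: the energy of `uₙ - u₀` is controlled by the
quadratic and Kirchhoff parts of `Φ'` tested against `uₙ - u₀`, up to a vanishing error. -/
lemma exists_energy_sub_le (ha : 0 < a) (hθ : 0 < θ) (hVp : ∀ x, θ ≤ Vp x) {β K : ℝ}
    (hβ : 0 < β) {u : ℕ → V → ℝ} {u₀ : V → ℝ} (hu : ∀ n, S.memE a Vp (u n))
    (hK : ∀ n, S.integral (S.energyDensity a Vp (u n)) ≤ K) (hlim : Tendsto u atTop (𝓝 u₀)) :
    S.memE a Vp u₀ ∧
    (∃ C, ∀ n, S.memE a Vp (u n - u₀) ∧ S.integral (S.energyDensity a Vp (u n - u₀)) ≤ C) ∧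
    ∃ δ : ℕ → ℝ, Tendsto δ atTop (𝓝 0) ∧ ∀ n,
      S.integral (S.energyDensity a Vp (u n - u₀)) ≤ S.innerE a Vp (u n) (u n - u₀) +
        β * S.integral (S.gradSq (u n)) * S.integral (S.gradDot (u n) (u n - u₀)) + δ n := by
  have hB := energyForm_isPosSemidef_of_le (S := S) ha hθ hVp
  have hG := S.gradForm_isPosSemidef
  simp only [memE_iff, integral_energyDensity] at hu hK
  have hu₀ : Summable fun x => S.energyForm a Vp x u₀ u₀ :=
    summable_bilin_of_tendsto hB hu hK fun x => S.tendsto_energyForm hlim hlim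
  have hw n : Summable fun x => S.energyForm a Vp x (u n - u₀) (u n - u₀) :=
    summable_bilin_sub hB (hu n) hu₀
  have hwK n : ∑' x, S.energyForm a Vp x (u n - u₀) (u n - u₀) ≤
      2 * K + 2 * ∑' x, S.energyForm a Vp x u₀ u₀ := by
    linarith [tsum_bilin_sub_le hB (hu n) hu₀, hK n]
  have hlim0 : Tendsto (fun n => u n - u₀) atTop (𝓝 0) := by
    simpa using hlim.sub_const u₀
  have hgu n := summable_gradForm ha hθ hVp (S.memE_iff.2 (hu n))
  have hgu₀ := summable_gradForm ha hθ hVp (S.memE_iff.2 hu₀)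
  have hgw n := summable_gradForm ha hθ hVp (S.memE_iff.2 (hw n))
  have hgwK n : ∑' x, S.gradForm x (u n - u₀) (u n - u₀) ≤
      (2 * K + 2 * ∑' x, S.energyForm a Vp x u₀ u₀) / a := by
    rw [le_div_iff₀' ha]
    have h := integral_gradSq_le ha hθ hVp (S.memE_iff.2 (hw n))
    rw [gradSq_eq_gradDot, integral_gradDot, integral_energyDensity] at h
    exact h.trans (hwK n)
  have hE0 : Tendsto (fun n => ∑' x, S.energyForm a Vp x u₀ (u n - u₀)) atTop (𝓝 0) :=
    tendsto_tsum_bilin_zero hB hu₀ hw hwK fun x => by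
      simpa using S.tendsto_energyForm (a := a) (Vp := Vp) (x := x)
        (tendsto_const_nhds (x := u₀)) hlim0
  have hG0 : Tendsto (fun n => ∑' x, S.gradForm x u₀ (u n - u₀)) atTop (𝓝 0) :=
    tendsto_tsum_bilin_zero hG hgu₀ hgw hgwK fun x => by
      simpa using S.tendsto_gradForm (x := x) (tendsto_const_nhds (x := u₀)) hlim0
  have hgK n : S.integral (S.gradSq (u n)) ≤ K / a := by
    rw [le_div_iff₀' ha]
    exact (integral_gradSq_le ha hθ hVp (S.memE_iff.2 (hu n))).trans
      ((S.integral_energyDensity a Vp (u n)).trans_le (hK n))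
  refine ⟨S.memE_iff.2 hu₀, ⟨_, fun n => ⟨S.memE_iff.2 (hw n),
    (S.integral_energyDensity a Vp _).trans_le (hwK n)⟩⟩,
    fun n => -(∑' x, S.energyForm a Vp x u₀ (u n - u₀)) -
      β * S.integral (S.gradSq (u n)) * ∑' x, S.gradForm x u₀ (u n - u₀), ?_, fun n => ?_⟩
  · have hprod : Tendsto (fun n => β * S.integral (S.gradSq (u n)) *
        ∑' x, S.gradForm x u₀ (u n - u₀)) atTop (𝓝 0) := by
      refine squeeze_zero_norm (a := fun n => β * (K / a) * ‖∑' x, S.gradForm x u₀ (u n - u₀)‖)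
        (fun n => ?_) (by simpa using hG0.norm.const_mul (β * (K / a)))
      have h0 := integral_gradSq_nonneg (S := S) (u n)
      rw [norm_mul, Real.norm_of_nonneg (by positivity)]
      gcongr
      exact hgK n
    simpa using hE0.neg.sub hprod
  · rw [integral_energyDensity, innerE_eq, tsum_bilin_sub_right hB (hu n) hu₀, integral_gradDot,
      tsum_bilin_sub_right hG (hgu n) hgu₀]
    have h0 := integral_gradSq_nonneg (S := S) (u n)
    have h1 : 0 ≤ ∑' x, S.gradForm x (u n - u₀) (u n - u₀) :=
      tsum_nonneg fun x => (hG x).nonneg _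
    have h2 := mul_nonneg (mul_nonneg hβ.le h0) h1
    linarith

end Energy

section Nonlinearity

variable {S}
variable {b : V → ℝ}

lemma summable_of_abs_le (hb : Summable fun x => b x * S.mu x) {f : V → ℝ} {A : ℝ}
    (hf : ∀ x, |f x| ≤ A * b x) : Summable fun x => f x * S.mu x := by
  refine Summable.of_norm_bounded (hb.mul_left A) fun x => ?_
  rw [norm_mul, Real.norm_eq_abs, Real.norm_of_nonneg (S.mu_pos x).le, ← mul_assoc]
  exact mul_le_mul_of_nonneg_right (hf x) (S.mu_pos x).le

lemma tendsto_integral_mul_zero (hb : Summable fun x => b x * S.mu x) {f w : ℕ → V → ℝ}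
    {A R : ℝ} (hf : ∀ n x, |f n x| ≤ A * b x) (hw : ∀ n x, |w n x| ≤ R)
    (hlim : Tendsto w atTop (𝓝 0)) :
    Tendsto (fun n => S.integral fun x => f n x * w n x) atTop (𝓝 0) := by
  have hle n x : ‖f n x * w n x * S.mu x‖ ≤ A * (b x * S.mu x) * |w n x| := by
    rw [norm_mul, norm_mul, Real.norm_eq_abs, Real.norm_eq_abs,
      Real.norm_of_nonneg (S.mu_pos x).le]
    have := mul_le_mul_of_nonneg_right (hf n x) (mul_nonneg (abs_nonneg (w n x)) (S.mu_pos x).le)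
    linarith
  have hA x : 0 ≤ A * (b x * S.mu x) := by
    rw [← mul_assoc]
    exact mul_nonneg ((abs_nonneg _).trans (hf 0 x)) (S.mu_pos x).le
  have := tendsto_tsum_of_dominated_convergence
    (f := fun n x => f n x * w n x * S.mu x) (g := fun _ => (0 : ℝ)) (𝓕 := atTop)
    (hb.mul_left A |>.mul_right R) (fun x => ?_)
    (Eventually.of_forall fun n x =>
      (hle n x).trans (mul_le_mul_of_nonneg_left (hw n x) (hA x)))
  · simpa [integral] using this
  · refine squeeze_zero_norm (fun n => hle n x) ?_
    simpa using (tendsto_pi_nhds.1 hlim x).abs.const_mul (A * (b x * S.mu x))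

lemma CondF1.exists_bound {F Fs Ft : V → ℝ → ℝ → ℝ} {a : ℝ → ℝ} (h : S.CondF1 F Fs Ft a b)
    (R₁ R₂ : ℝ) : ∃ A : ℝ, ∀ x s t, |s| ≤ R₁ → |t| ≤ R₂ →
      |Fs x s t| ≤ A * b x ∧ |Ft x s t| ≤ A * b x ∧ |F x s t| ≤ A * b x := by
  obtain ⟨hc, -, hb, -, hF⟩ := h
  obtain ⟨A, hA⟩ := isCompact_Icc.bddAbove_image
    (hc.mono (Set.Icc_subset_Ici_self : Set.Icc 0 √(R₁ ^ 2 + R₂ ^ 2) ⊆ _))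
  refine ⟨A, fun x s t hs ht => ?_⟩
  have hst : √(s ^ 2 + t ^ 2) ≤ √(R₁ ^ 2 + R₂ ^ 2) :=
    Real.sqrt_le_sqrt (add_le_add (sq_le_sq' (abs_le.1 hs).1 (abs_le.1 hs).2)
      (sq_le_sq' (abs_le.1 ht).1 (abs_le.1 ht).2))
  have hle : a √(s ^ 2 + t ^ 2) * b x ≤ A * b x :=
    mul_le_mul_of_nonneg_right (hA ⟨_, ⟨Real.sqrt_nonneg _, hst⟩, rfl⟩) (hb x).le
  obtain ⟨h1, h2, h3⟩ := hF x s t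
  exact ⟨h1.trans hle, h2.trans hle, h3.trans hle⟩

/-- The integrated form of condition (F₅). -/
lemma integral_superquadratic {F Fs Ft : V → ℝ → ℝ → ℝ} {a : ℝ → ℝ}
    (h : S.CondF1 F Fs Ft a b) {μb σ R₁ R₂ : ℝ}
    (hF5 : ∀ (x : V) (s t : ℝ),
      μb * F x s t ≤ s * Fs x s t + t * Ft x s t + σ * (s ^ 2 + t ^ 2))
    {u v : V → ℝ} (hu : ∀ x, |u x| ≤ R₁) (hv : ∀ x, |v x| ≤ R₂)
    (hu2 : Summable fun x => u x ^ 2 * S.mu x) (hv2 : Summable fun x => v x ^ 2 * S.mu x) :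
    μb * S.integral (fun x => F x (u x) (v x)) ≤
      S.integral (fun x => Fs x (u x) (v x) * u x) +
      S.integral (fun x => Ft x (u x) (v x) * v x) +
      σ * (∑' x, u x ^ 2 * S.mu x + ∑' x, v x ^ 2 * S.mu x) := by
  obtain ⟨A, hA⟩ := h.exists_bound R₁ R₂
  have hb := h.2.2.2.1
  have hprod : ∀ {f w : V → ℝ} {R : ℝ}, (∀ x, |f x| ≤ A * b x) → (∀ x, |w x| ≤ R) →
      Summable fun x => f x * w x * S.mu x := fun {f w R} hf hw =>
    summable_of_abs_le (A := A * R) hb fun x => by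
      rw [abs_mul, mul_right_comm]
      exact mul_le_mul (hf x) (hw x) (abs_nonneg _) ((abs_nonneg _).trans (hf x))
  have h0 := (summable_of_abs_le hb fun x => (hA x _ _ (hu x) (hv x)).2.2).mul_left μb
  have h1 := hprod (fun x => (hA x _ _ (hu x) (hv x)).1) hu
  have h2 := hprod (fun x => (hA x _ _ (hu x) (hv x)).2.1) hv
  have h3 := (hu2.add hv2).mul_left σ
  simp only [integral]
  rw [← hu2.tsum_add hv2, ← tsum_mul_left, ← tsum_mul_left, ← h1.tsum_add h2,
    ← (h1.add h2).tsum_add h3]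
  refine h0.tsum_le_tsum (fun x => ?_) ((h1.add h2).add h3)
  have := mul_le_mul_of_nonneg_right (hF5 x (u x) (v x)) (S.mu_pos x).le
  linarith

end Nonlinearity

/-- Under (F₅) with exponent above `4`, Cerami sequences have bounded energy. -/
lemma CeramiSeq.exists_energy_le {S : WeightedGraph V} {a₁ a₂ b₁ b₂ θ₁ θ₂ : ℝ} (ha₁ : 0 < a₁)
    (ha₂ : 0 < a₂) (hb₁ : 0 < b₁) (hb₂ : 0 < b₂) {V₁ V₂ : V → ℝ} (hθ₁ : 0 < θ₁) (hθ₂ : 0 < θ₂)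
    (hV₁ : ∀ x, θ₁ ≤ V₁ x) (hV₂ : ∀ x, θ₂ ≤ V₂ x) {F Fs Ft : V → ℝ → ℝ → ℝ} {a : ℝ → ℝ}
    {b : V → ℝ} (hF1 : S.CondF1 F Fs Ft a b) (hF5 : CondF5 4 F Fs Ft θ₁ θ₂) {u v : ℕ → V → ℝ}
    (hcer : S.CeramiSeq a₁ a₂ b₁ b₂ V₁ V₂ F Fs Ft u v) :
    ∃ K, ∀ n, S.integral (S.energyDensity a₁ V₁ (u n)) ≤ K ∧
      S.integral (S.energyDensity a₂ V₂ (v n)) ≤ K := by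
  obtain ⟨hmem, ⟨C, hC⟩, ε, hε, hder⟩ := hcer
  obtain ⟨μb, hμ, σ, hσ, hσ', h5⟩ := hF5
  obtain ⟨e, he⟩ := hε.bddAbove_range
  set m := max (gamma2 θ₁ ^ 2) (gamma2 θ₂ ^ 2) with hm
  have hg : ∀ θ : ℝ, 0 < θ → gamma2 θ ^ 2 = 1 / θ := fun θ h => by
    rw [gamma2, div_pow, Real.sq_sqrt h.le, one_pow]
  have hm1 : 1 / θ₁ ≤ m := hg θ₁ hθ₁ ▸ le_max_left _ _
  have hm2 : 1 / θ₂ ≤ m := hg θ₂ hθ₂ ▸ le_max_right _ _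
  have hm0 : 0 < m := (by positivity : 0 < 1 / θ₁).trans_le hm1
  rw [lt_div_iff₀ (by positivity)] at hσ'
  have hκ : 0 < (μb - 2) / 2 - σ * m := by linarith
  refine ⟨(μb * C + e) / ((μb - 2) / 2 - σ * m), fun n => ?_⟩
  obtain ⟨hu, hv⟩ := hmem n
  have hX := integral_energyDensity_nonneg (S := S) ha₁ hθ₁ hV₁ (u n)
  have hY := integral_energyDensity_nonneg (S := S) ha₂ hθ₂ hV₂ (v n)
  have hQ : ∀ {θ X Q : ℝ}, 0 < θ → 1 / θ ≤ m → 0 ≤ X → θ * Q ≤ X → Q ≤ m * X :=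
    fun {θ X Q} h0 h1 h2 h3 => by
      have h4 : Q ≤ X / θ := by rwa [le_div_iff₀' h0]
      have h5 := mul_le_mul_of_nonneg_right h1 h2
      rw [one_div_mul_eq_div] at h5
      exact h4.trans h5
  have hQ1 := hQ hθ₁ hm1 hX (integral_sq_le ha₁ hθ₁ hV₁ hu)
  have hQ2 := hQ hθ₂ hm2 hY (integral_sq_le ha₂ hθ₂ hV₂ hv)
  have hT := integral_superquadratic hF1 h5
    (abs_le_of_integral_energyDensity_le ha₁ hθ₁ hV₁ hu le_rfl)
    (abs_le_of_integral_energyDensity_le ha₂ hθ₂ hV₂ hv le_rfl)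
    (summable_sq_mul_mu ha₁ hθ₁ hV₁ hu) (summable_sq_mul_mu ha₂ hθ₂ hV₂ hv)
  have hD : |S.PhiDeriv a₁ a₂ b₁ b₂ V₁ V₂ Fs Ft (u n) (v n) (u n) (v n)| ≤ e := by
    have h := S.abs_PhiDeriv_le (hder n) hu hv
    rw [mul_comm] at h
    exact (le_of_mul_le_mul_right h (by
      linarith [S.normE_nonneg a₁ V₁ (u n), S.normE_nonneg a₂ V₂ (v n)])).trans (he ⟨n, rfl⟩)
  have hP := mul_le_mul_of_nonneg_left ((le_abs_self _).trans (hC n))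
    (by linarith : (0 : ℝ) ≤ μb)
  have hD' := (neg_le_abs _).trans hD
  simp only [Phi, PhiDeriv, innerE_eq, ← integral_energyDensity, ← gradSq_eq_gradDot] at hP hD'
  have hσQ := mul_le_mul_of_nonneg_left (add_le_add hQ1 hQ2) hσ.le
  have hk1 := mul_nonneg (mul_nonneg hb₁.le (by linarith : 0 ≤ μb / 4 - 1))
    (sq_nonneg (S.integral (S.gradSq (u n))))
  have hk2 := mul_nonneg (mul_nonneg hb₂.le (by linarith : 0 ≤ μb / 4 - 1))
    (sq_nonneg (S.integral (S.gradSq (v n))))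
  have hsum : ((μb - 2) / 2 - σ * m) * (S.integral (S.energyDensity a₁ V₁ (u n)) +
      S.integral (S.energyDensity a₂ V₂ (v n))) ≤ μb * C + e := by
    linarith
  rw [← le_div_iff₀' hκ] at hsum
  exact ⟨by linarith, by linarith⟩

/-- Bounded sequences of functions on a countable set have a pointwise convergent subsequence. -/
lemma exists_subseq_tendsto [Countable V] {u v : ℕ → V → ℝ} {R₁ R₂ : ℝ}
    (hu : ∀ n x, |u n x| ≤ R₁) (hv : ∀ n x, |v n x| ≤ R₂) :
    ∃ ns : ℕ → ℕ, StrictMono ns ∧ ∃ u₀ v₀ : V → ℝ,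
      Tendsto (fun j => u (ns j)) atTop (𝓝 u₀) ∧ Tendsto (fun j => v (ns j)) atTop (𝓝 v₀) := by
  have hc : ∀ R : ℝ, IsCompact (Set.pi Set.univ fun _ : V => Set.Icc (-R) R) := fun R =>
    isCompact_univ_pi fun _ => isCompact_Icc
  obtain ⟨p, -, ns, hns, hp⟩ := ((hc R₁).prod (hc R₂)).tendsto_subseq
    (x := fun n => (u n, v n))
    fun n => ⟨fun x _ => abs_le.1 (hu n x), fun x _ => abs_le.1 (hv n x)⟩
  exact ⟨ns, hns, p.1, p.2, (continuous_fst.tendsto p).comp hp, (continuous_snd.tendsto p).comp hp⟩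

end WeightedGraph

/-- Lemma 3.3: under `b₁, b₂ > 0`, (V), (F₀), (F₁), (F₂), (F₃), (F₅), every Cerami
sequence for `Φ` has a subsequence converging in the norm of `E`. -/
theorem cerami_sequence_convergent_F5
    {V : Type*} (S : WeightedGraph V)
    (a₁ a₂ b₁ b₂ : ℝ) (ha₁ : 0 < a₁) (ha₂ : 0 < a₂) (hb₁ : 0 < b₁) (hb₂ : 0 < b₂)
    (V₁ V₂ : V → ℝ) (θ₁ θ₂ : ℝ) (hV : S.CondV V₁ V₂ θ₁ θ₂)
    (F Fs Ft : V → ℝ → ℝ → ℝ) (hFder : IsPartialDerivs F Fs Ft)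
    (a : ℝ → ℝ) (b : V → ℝ) (r₀ : ℝ) (hr₀ : 0 < r₀)
    (hF0 : CondF0 F) (hF1 : S.CondF1 F Fs Ft a b)
    (hF2 : CondF2 F) (hF3 : CondF3 F r₀) (hF5 : CondF5 4 F Fs Ft θ₁ θ₂)
    (u v : ℕ → V → ℝ)
    (hcer : S.CeramiSeq a₁ a₂ b₁ b₂ V₁ V₂ F Fs Ft u v) :
    ∃ ns : ℕ → ℕ, StrictMono ns ∧ ∃ ulim vlim : V → ℝ,
      S.memE a₁ V₁ ulim ∧ S.memE a₂ V₂ vlim ∧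
      Tendsto (fun j => S.normE a₁ V₁ (fun x => u (ns j) x - ulim x)) atTop (nhds 0) ∧
      Tendsto (fun j => S.normE a₂ V₂ (fun x => v (ns j) x - vlim x)) atTop (nhds 0) := by
  obtain ⟨hg₁, hg₂, hθ₁, hθ₂, -⟩ := hV
  have hV₁ : ∀ x, θ₁ ≤ V₁ x := fun x => hg₁.1 ⟨x, rfl⟩
  have hV₂ : ∀ x, θ₂ ≤ V₂ x := fun x => hg₂.1 ⟨x, rfl⟩
  have hbμ := hF1.2.2.2.1
  have : Countable V := by
    refine Set.countable_univ_iff.1 (hbμ.countable_support.mono fun x _ => ?_)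
    exact (mul_pos (hF1.2.2.1 x) (S.mu_pos x)).ne'
  obtain ⟨K, hK⟩ := hcer.exists_energy_le ha₁ ha₂ hb₁ hb₂ hθ₁ hθ₂ hV₁ hV₂ hF1 hF5
  obtain ⟨hmem, -, ε, hε, hder⟩ := hcer
  have hu n := abs_le_of_integral_energyDensity_le ha₁ hθ₁ hV₁ (hmem n).1 (hK n).1
  have hv n := abs_le_of_integral_energyDensity_le ha₂ hθ₂ hV₂ (hmem n).2 (hK n).2
  obtain ⟨ns, hns, u₀, v₀, hulim, hvlim⟩ := exists_subseq_tendsto hu hv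
  obtain ⟨hu₀, ⟨C₁, hC₁⟩, δ₁, hδ₁, hle₁⟩ := exists_energy_sub_le ha₁ hθ₁ hV₁ hb₁
    (fun j => (hmem (ns j)).1) (fun j => (hK (ns j)).1) hulim
  obtain ⟨hv₀, ⟨C₂, hC₂⟩, δ₂, hδ₂, hle₂⟩ := exists_energy_sub_le ha₂ hθ₂ hV₂ hb₂
    (fun j => (hmem (ns j)).2) (fun j => (hK (ns j)).2) hvlim
  obtain ⟨A, hA⟩ := hF1.exists_bound √(K / (θ₁ * S.mumin)) √(K / (θ₂ * S.mumin))
  have hT₁ := tendsto_integral_mul_zero hbμ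
    (f := fun j x => Fs x (u (ns j) x) (v (ns j) x)) (w := fun j => u (ns j) - u₀)
    (fun j x => (hA x _ _ (hu (ns j) x) (hv (ns j) x)).1)
    (fun j => abs_le_of_integral_energyDensity_le ha₁ hθ₁ hV₁ (hC₁ j).1 (hC₁ j).2)
    (by simpa using hulim.sub_const u₀)
  have hT₂ := tendsto_integral_mul_zero hbμ
    (f := fun j x => Ft x (u (ns j) x) (v (ns j) x)) (w := fun j => v (ns j) - v₀)
    (fun j x => (hA x _ _ (hu (ns j) x) (hv (ns j) x)).2.1)
    (fun j => abs_le_of_integral_energyDensity_le ha₂ hθ₂ hV₂ (hC₂ j).1 (hC₂ j).2)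
    (by simpa using hvlim.sub_const v₀)
  have hD : Tendsto (fun j => S.PhiDeriv a₁ a₂ b₁ b₂ V₁ V₂ Fs Ft (u (ns j)) (v (ns j))
      (u (ns j) - u₀) (v (ns j) - v₀)) atTop (𝓝 0) := by
    refine squeeze_zero_norm (a := fun j => |ε (ns j)| * (1 + (√C₁ + √C₂))) (fun j => ?_)
      (by simpa using (hε.comp hns.tendsto_atTop).abs.mul_const (1 + (√C₁ + √C₂)))
    have h := S.abs_PhiDeriv_le (hder (ns j)) (hC₁ j).1 (hC₂ j).1
    have h1 : S.normE a₁ V₁ (u (ns j) - u₀) ≤ √C₁ := Real.sqrt_le_sqrt (hC₁ j).2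
    have h2 : S.normE a₂ V₂ (v (ns j) - v₀) ≤ √C₂ := Real.sqrt_le_sqrt (hC₂ j).2
    have n1 := S.normE_nonneg a₁ V₁ (u (ns j) - u₀)
    have n2 := S.normE_nonneg a₂ V₂ (v (ns j) - v₀)
    have n3 := S.normE_nonneg a₁ V₁ (u (ns j))
    have n4 := S.normE_nonneg a₂ V₂ (v (ns j))
    rw [Real.norm_eq_abs]
    refine (le_mul_of_one_le_left (abs_nonneg _) (by linarith)).trans (h.trans ?_)
    gcongr
    exact le_abs_self _
  have hbound := (((hD.add hT₁).add hT₂).add hδ₁).add hδ₂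
  simp only [add_zero] at hbound
  have hX j := integral_energyDensity_nonneg (S := S) ha₁ hθ₁ hV₁ (u (ns j) - u₀)
  have hY j := integral_energyDensity_nonneg (S := S) ha₂ hθ₂ hV₂ (v (ns j) - v₀)
  refine ⟨ns, hns, u₀, v₀, hu₀, hv₀, ?_, ?_⟩
  · have h := (squeeze_zero hX (fun j => ?_) hbound).sqrt
    · rwa [Real.sqrt_zero] at h
    · have h1 := hle₁ j
      have h2 := hle₂ j
      have h3 := hY j
      simp only [PhiDeriv]
      linarith
  · have h := (squeeze_zero hY (fun j => ?_) hbound).sqrt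
    · rwa [Real.sqrt_zero] at h
    · have h1 := hle₁ j
      have h2 := hle₂ j
      have h3 := hX j
      simp only [PhiDeriv]
      linarith
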